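/- arXiv:2211.00904 — 4 statements merged into one kernel-verified Lean document; each statement's English description precedes it below -/
import Mathlib

section
/- Let G be a finite connected simple graph with n vertices and m edges (n ≥ 2). Let U_Gr be the Grover transition matrix of G and T its probability transition matrix. Then the following polynomial identity in λ holds: (λ² − 1)^n · det(λ·I − U_Gr) = (λ² − 1)^m · det((λ² + 1)·I − 2λ·T). -/
open Matrix

/-- The Grover transition matrix of a finite simple graph, indexed by darts:
`U_Gr(a,a') = (2/deg(tail a)) · [head a' = tail a] − [a' = ā]`. -/
noncomputable def groverMatrix {V : Type*} [Fintype V] [DecidableEq V] (G : SimpleGraph V)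
    [DecidableRel G.Adj] : Matrix G.Dart G.Dart ℂ := fun a a' =>
  (2 / (G.degree a.fst : ℂ)) * (if a'.snd = a.fst then 1 else 0) -
    (if a' = a.symm then 1 else 0)

/-- The probability transition matrix of a finite simple graph:
`T(u,v) = 1/deg(u)` if `{u,v}` is an edge, `0` otherwise. -/
noncomputable def probTransMatrix {V : Type*} [Fintype V] [DecidableEq V] (G : SimpleGraph V)
    [DecidableRel G.Adj] : Matrix V V ℂ := fun u v =>
  if G.Adj u v then 1 / (G.degree u : ℂ) else 0

theorem smul_one_add_mul_smul_one_sub {R A : Type*} [CommRing R] [Ring A] [Algebra R A] {a : A}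
    (ha : a * a = 1) (r : R) : (r • 1 + a) * (r • 1 - a) = (r ^ 2 - 1) • (1 : A) := by
  simp only [add_mul, mul_sub, smul_mul_assoc, mul_smul_comm, one_mul, mul_one, ha, sub_smul,
    one_smul, smul_add, smul_smul, pow_two]
  abel

open Polynomial in
/-- The characteristic polynomial of an involution which is similar to its negative. -/
theorem charpoly_eq_of_mul_self_eq_one {ι : Type*} [Fintype ι] [DecidableEq ι]
    {J D : Matrix ι ι ℂ} {k : ℕ} (hJ : J * J = 1) (hD : D * D = 1) (hDJ : D * J * D = -J)
    (hk : Fintype.card ι = 2 * k) : J.charpoly = (X ^ 2 - 1) ^ k := by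
  have hneg : (-J).charpoly = J.charpoly := by
    rw [← hDJ, Matrix.charpoly_mul_comm, ← Matrix.mul_assoc, hD, Matrix.one_mul]
  have hmul : J.charmatrix * (-J).charmatrix = (X ^ 2 - 1 : ℂ[X]) • 1 := by
    have hJ' : J.map C * J.map C = (1 : Matrix ι ι ℂ[X]) := by
      rw [← Matrix.map_mul, hJ, Matrix.map_one C C_0 C_1]
    have hneg' : (-J).map C = -(J.map (C : ℂ →+* ℂ[X])) := by
      ext; simp
    have hnn : -(J.map (C : ℂ →+* ℂ[X])) * -(J.map C) = 1 := by rw [neg_mul_neg, hJ']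
    simpa only [charmatrix, RingHom.mapMatrix_apply, scalar_apply, ← smul_one_eq_diagonal, hneg',
      ← sub_eq_add_neg] using smul_one_add_mul_smul_one_sub hnn (X : ℂ[X])
  have hsq : J.charpoly ^ 2 = ((X ^ 2 - 1) ^ k : ℂ[X]) ^ 2 := by
    rw [pow_two]
    nth_rewrite 2 [← hneg]
    rw [charpoly, charpoly, ← det_mul, hmul, det_smul, det_one, mul_one, hk, mul_comm 2 k, pow_mul]
  have hmonic : ((X ^ 2 - 1 : ℂ[X]) ^ k).Monic := by
    simpa using (monic_X_pow_sub_C (1 : ℂ) two_ne_zero).pow k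
  rcases sq_eq_sq_iff_eq_or_eq_neg.mp hsq with h | h
  · exact h
  · have hlead := congrArg leadingCoeff h
    rw [leadingCoeff_neg, hmonic.leadingCoeff, (charpoly_monic J).leadingCoeff] at hlead
    norm_num at hlead

namespace SimpleGraph

theorem exists_dart_orientation {V : Type*} [Fintype V] (G : SimpleGraph V) :
    ∃ s : G.Dart → ℂ, (∀ a, s a * s a = 1) ∧ ∀ a, s a.symm = -s a := by
  let e := Fintype.equivFin V
  refine ⟨fun a => if e a.fst < e a.snd then 1 else -1, fun a => ?_, fun a => ?_⟩
  · dsimp only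
    split_ifs <;> norm_num
  · have h : e a.fst ≠ e a.snd := e.injective.ne a.fst_ne_snd
    simp only [Dart.symm_toProd, Prod.fst_swap, Prod.snd_swap]
    rcases lt_or_gt_of_ne h with h | h
    · rw [if_pos h, if_neg h.not_gt]
    · rw [if_pos h, if_neg h.not_gt, neg_neg]

variable {V : Type*} [Fintype V] [DecidableEq V] (G : SimpleGraph V) [DecidableRel G.Adj]

/-- The matrix reversing the darts of a graph. -/
def dartReversal : Matrix G.Dart G.Dart ℂ := fun a a' => if a' = a.symm then 1 else 0

/-- The weighted incidence matrix of darts and their tails. -/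
noncomputable def tailMatrix : Matrix G.Dart V ℂ := fun a v =>
  if a.fst = v then 2 / (G.degree v : ℂ) else 0

/-- The incidence matrix of vertices and the darts pointing to them. -/
def headMatrix : Matrix V G.Dart ℂ := fun v a => if a.snd = v then 1 else 0

theorem groverMatrix_eq : groverMatrix G = G.tailMatrix * G.headMatrix - G.dartReversal := by
  ext a a'
  simp [groverMatrix, tailMatrix, headMatrix, dartReversal, Matrix.mul_apply, -mul_ite]

theorem dartReversal_mul_apply {ι : Type*} (M : Matrix G.Dart ι ℂ) (a : G.Dart) (i : ι) :
    (G.dartReversal * M) a i = M a.symm i := by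
  simp [dartReversal, Matrix.mul_apply]

theorem dartReversal_mul_self : G.dartReversal * G.dartReversal = 1 := by
  ext a a'
  rw [dartReversal_mul_apply]
  simp [dartReversal, Matrix.one_apply, eq_comm]

theorem headMatrix_mul_tailMatrix :
    G.headMatrix * G.tailMatrix = (2 : ℂ) • (probTransMatrix G)ᵀ := by
  ext u v
  simp only [Matrix.mul_apply, headMatrix, tailMatrix, probTransMatrix, Matrix.smul_apply,
    Matrix.transpose_apply, smul_eq_mul, ite_mul, one_mul, zero_mul]
  by_cases h : G.Adj v u
  · rw [Finset.sum_eq_single (⟨(v, u), h⟩ : G.Dart)]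
    · simp [h, div_eq_mul_inv]
    · rintro ⟨⟨x, y⟩, hxy⟩ - hne
      simp only [ne_eq, Dart.mk.injEq, Prod.mk.injEq, not_and] at hne
      grind
    · simp
  · rw [if_neg h, mul_zero]
    refine Finset.sum_eq_zero fun a _ => ?_
    have ha := a.adj
    grind

theorem headMatrix_mul_dartReversal_mul_tailMatrix (hdeg : ∀ v, G.degree v ≠ 0) :
    G.headMatrix * (G.dartReversal * G.tailMatrix) = (2 : ℂ) • 1 := by
  ext u v
  simp only [Matrix.mul_apply (M := G.headMatrix), dartReversal_mul_apply, headMatrix, tailMatrix,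
    ite_mul, one_mul, zero_mul, Matrix.smul_apply, Matrix.one_apply, smul_eq_mul]
  have hfst (a : G.Dart) : a.symm.fst = a.snd := rfl
  simp only [hfst]
  by_cases h : u = v
  · subst h
    have hcard : (Finset.univ.filter fun a : G.Dart => a.snd = u).card = G.degree u := by
      rw [← G.dart_fst_fiber_card_eq_degree u]
      refine Finset.card_bij (fun a _ => a.symm) (by simp) (fun a _ b _ hab => ?_) fun b hb =>
        ⟨b.symm, by simpa using hb, b.symm_symm⟩
      exact Dart.symm_involutive.injective hab
    have hu : (G.degree u : ℂ) ≠ 0 := Nat.cast_ne_zero.mpr (hdeg u)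
    rw [← Finset.sum_filter, Finset.sum_congr rfl (g := fun _ => 2 / (G.degree u : ℂ)),
      Finset.sum_const, hcard]
    · simp; field_simp
    · intro a ha
      simp_all
  · rw [if_neg h, mul_zero]
    exact Finset.sum_eq_zero fun a _ => by grind

open Polynomial in
theorem charpoly_dartReversal :
    G.dartReversal.charpoly = (X ^ 2 - 1) ^ G.edgeFinset.card := by
  obtain ⟨s, hs, hsymm⟩ := G.exists_dart_orientation
  refine charpoly_eq_of_mul_self_eq_one (D := Matrix.diagonal s) G.dartReversal_mul_self ?_ ?_
    G.dart_card_eq_twice_card_edges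
  · rw [Matrix.diagonal_mul_diagonal, ← Matrix.diagonal_one]
    exact congrArg _ (funext hs)
  · ext a a'
    rw [Matrix.mul_diagonal, Matrix.diagonal_mul, Matrix.neg_apply, dartReversal]
    split_ifs with h
    · rw [h, hsymm, mul_one, mul_neg, hs]
    · simp

theorem det_smul_one_add_dartReversal (z : ℂ) :
    (z • 1 + G.dartReversal).det = (z ^ 2 - 1) ^ G.edgeFinset.card := by
  have h := congrArg (Polynomial.eval (-z)) G.charpoly_dartReversal
  rw [Matrix.eval_charpoly, scalar_apply, ← smul_one_eq_diagonal] at h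
  have hneg : z • 1 + G.dartReversal = -((-z) • 1 - G.dartReversal) := by
    rw [neg_smul]; abel
  rw [hneg, Matrix.det_neg, h, G.dart_card_eq_twice_card_edges]
  simp

end SimpleGraph

theorem konno_sato_identity {V : Type*} [Fintype V] [DecidableEq V] (G : SimpleGraph V)
    [DecidableRel G.Adj] (hconn : G.Connected) (hn : 2 ≤ Fintype.card V) (lam : ℂ) :
    (lam ^ 2 - 1) ^ (Fintype.card V) *
        Matrix.det (lam • (1 : Matrix G.Dart G.Dart ℂ) - groverMatrix G) =
      (lam ^ 2 - 1) ^ (G.edgeFinset.card) *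
        Matrix.det ((lam ^ 2 + 1) • (1 : Matrix V V ℂ) - (2 * lam) • probTransMatrix G) := by
  have : Nontrivial V := Fintype.one_lt_card_iff_nontrivial.mp hn
  have hdeg (v : V) : G.degree v ≠ 0 := (hconn.preconnected.degree_pos_of_nontrivial v).ne'
  by_cases hz : lam ^ 2 - 1 = 0
  · obtain ⟨v⟩ := hconn.nonempty
    obtain ⟨w, hw⟩ := (G.degree_pos_iff_exists_adj v).mp (Nat.pos_of_ne_zero (hdeg v))
    have hm : G.edgeFinset.card ≠ 0 :=
      Finset.card_ne_zero_of_mem (SimpleGraph.mem_edgeFinset.mpr (G.mem_edgeSet.mpr hw))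
    rw [hz, zero_pow (by omega), zero_pow hm, zero_mul, zero_mul]
  · set c := lam ^ 2 - 1 with hc
    set J := G.dartReversal
    set A := G.tailMatrix
    set B := G.headMatrix
    have hinv : (lam • 1 + J) * (lam • 1 - J) = c • 1 :=
      smul_one_add_mul_smul_one_sub G.dartReversal_mul_self lam
    have hfactor : lam • 1 - groverMatrix G =
        (lam • 1 + J) * (1 - (c⁻¹ • ((lam • 1 - J) * A)) * B) := by
      rw [G.groverMatrix_eq, mul_sub, mul_one, Matrix.smul_mul, mul_smul_comm, Matrix.mul_assoc,
        ← Matrix.mul_assoc (lam • 1 + J), hinv, Matrix.smul_mul, Matrix.one_mul, smul_smul,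
        inv_mul_cancel₀ hz, one_smul]
      abel
    have hBA : B * ((lam • 1 - J) * A) = (2 * lam) • (probTransMatrix G)ᵀ - (2 : ℂ) • 1 := by
      rw [Matrix.sub_mul, Matrix.smul_mul, Matrix.one_mul, Matrix.mul_sub, Matrix.mul_smul,
        G.headMatrix_mul_tailMatrix, G.headMatrix_mul_dartReversal_mul_tailMatrix hdeg, smul_smul,
        mul_comm lam]
    have hT : c • (1 - c⁻¹ • ((2 * lam) • (probTransMatrix G)ᵀ - (2 : ℂ) • 1)) =
        ((lam ^ 2 + 1) • 1 - (2 * lam) • probTransMatrix G)ᵀ := by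
      rw [smul_sub, smul_smul, mul_inv_cancel₀ hz, one_smul, transpose_sub, transpose_smul,
        transpose_smul, transpose_one, show lam ^ 2 + 1 = c + 2 by rw [hc]; ring, add_smul]
      abel
    rw [hfactor, det_mul, G.det_smul_one_add_dartReversal, det_one_sub_mul_comm, Matrix.mul_smul,
      hBA, mul_left_comm, ← det_smul, hT, det_transpose]
end

section
/- Let G be a finite connected simple graph with n vertices and m edges such that m > n. Then a complex number λ is an eigenvalue of the Grover transition matrix U_Gr if and only if λ ∈ {1, −1} or there exists an eigenvalue μ of the probability transition matrix T such that λ² − 2μλ + 1 = 0. -/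
open Matrix

open Finset in
lemma sum_dart_snd_eq {V : Type*} [Fintype V] [DecidableEq V] (G : SimpleGraph V)
    [DecidableRel G.Adj] (v : V) (h : V → ℂ) :
    ∑ a : G.Dart, (if a.snd = v then h a.fst else 0) = ∑ u ∈ G.neighborFinset v, h u := by
  rw [← sum_filter]
  refine sum_bij' (fun a _ => a.fst)
    (fun u hu => ⟨(u, v), ((G.mem_neighborFinset v u).1 hu).symm⟩) ?_ ?_ ?_ ?_ ?_
  · intro a ha
    have hv : a.snd = v := (mem_filter.1 ha).2
    exact (G.mem_neighborFinset v _).2 (hv ▸ a.adj.symm)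
  · intro u _
    simp
  · intro a ha
    have hv : a.snd = v := (mem_filter.1 ha).2
    subst hv
    rfl
  · intro u _
    rfl
  · intro a _
    rfl

lemma groverMatrix_mulVec {V : Type*} [Fintype V] [DecidableEq V] (G : SimpleGraph V)
    [DecidableRel G.Adj] (f : G.Dart → ℂ) (a : G.Dart) :
    (groverMatrix G *ᵥ f) a =
      2 / (G.degree a.fst : ℂ) * (∑ b : G.Dart, if b.snd = a.fst then f b else 0) -
        f a.symm := by
  simp [groverMatrix, mulVec, dotProduct, sub_mul, Finset.sum_sub_distrib, Finset.mul_sum]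

lemma probTransMatrix_mulVec {V : Type*} [Fintype V] [DecidableEq V] (G : SimpleGraph V)
    [DecidableRel G.Adj] (φ : V → ℂ) (v : V) :
    (probTransMatrix G *ᵥ φ) v = (∑ u ∈ G.neighborFinset v, φ u) / (G.degree v : ℂ) := by
  simp [probTransMatrix, mulVec, dotProduct, SimpleGraph.neighborFinset_eq_filter,
    Finset.sum_filter, Finset.mul_sum, div_eq_inv_mul]

lemma det_smul_one_sub_eq_zero_iff {ι : Type*} [Fintype ι] [DecidableEq ι] (M : Matrix ι ι ℂ)
    (c : ℂ) : (c • (1 : Matrix ι ι ℂ) - M).det = 0 ↔ ∃ f ≠ 0, M *ᵥ f = c • f := by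
  rw [← exists_mulVec_eq_zero_iff]
  simp only [sub_mulVec, smul_mulVec, one_mulVec, sub_eq_zero, eq_comm]

/-- If `s` is a nowhere vanishing weight on darts with `s ā = -c s a`, then some nonzero
function `s a * g (edge a)` sums to zero over the darts into each vertex. -/
lemma exists_groverMatrix_eigenvector_of_weight {V : Type*} [Fintype V] [DecidableEq V]
    (G : SimpleGraph V) [DecidableRel G.Adj] (hm : Fintype.card V < G.edgeFinset.card)
    (c : ℂ) (s : G.Dart → ℂ) (hs : ∀ a, s a ≠ 0) (hsymm : ∀ a, s a.symm = -c * s a) :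
    ∃ f ≠ 0, groverMatrix G *ᵥ f = c • f := by
  let L : (G.edgeSet → ℂ) →ₗ[ℂ] (V → ℂ) :=
    { toFun := fun g v => ∑ b : G.Dart, if b.snd = v then s b * g ⟨b.edge, b.edge_mem⟩ else 0
      map_add' := fun g g' => by
        ext v
        simp only [Pi.add_apply, ← Finset.sum_add_distrib]
        refine Finset.sum_congr rfl fun b _ => ?_
        split_ifs <;> ring
      map_smul' := fun r g => by
        ext v
        simp only [Pi.smul_apply, smul_eq_mul, RingHom.id_apply, Finset.mul_sum]
        refine Finset.sum_congr rfl fun b _ => ?_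
        split_ifs <;> ring }
  have hker : LinearMap.ker L ≠ ⊥ := LinearMap.ker_ne_bot_of_finrank_lt (by
    rw [Module.finrank_fintype_fun_eq_card, Module.finrank_fintype_fun_eq_card,
      ← SimpleGraph.edgeFinset_card]
    exact hm)
  obtain ⟨g, hg, hg0⟩ := (Submodule.ne_bot_iff _).1 hker
  refine ⟨fun a => s a * g ⟨a.edge, a.edge_mem⟩, ?_, ?_⟩
  · contrapose! hg0
    ext ⟨e, he⟩
    induction e with
    | _ u v =>
      have := congrFun hg0 ⟨(u, v), he⟩
      exact (mul_eq_zero.1 this).resolve_left (hs _)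
  · ext a
    have hsum : (∑ b : G.Dart, if b.snd = a.fst then s b * g ⟨b.edge, b.edge_mem⟩ else 0) = 0 :=
      congrFun (LinearMap.mem_ker.1 hg) a.fst
    rw [groverMatrix_mulVec, hsum]
    simp [hsymm, mul_assoc]

lemma exists_groverMatrix_eigenvector_one {V : Type*} [Fintype V] [DecidableEq V]
    (G : SimpleGraph V) [DecidableRel G.Adj] (hm : Fintype.card V < G.edgeFinset.card) :
    ∃ f ≠ 0, groverMatrix G *ᵥ f = (1 : ℂ) • f := by
  let e := Fintype.equivFin V
  refine exists_groverMatrix_eigenvector_of_weight G hm 1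
    (fun a => if e a.fst < e a.snd then 1 else -1) (fun a => ?_) fun a => ?_
  · split_ifs <;> simp
  · have hne : e a.fst ≠ e a.snd := e.injective.ne a.adj.ne
    rcases hne.lt_or_gt with h | h <;> simp [h, h.not_gt]

lemma exists_groverMatrix_eigenvector_neg_one {V : Type*} [Fintype V] [DecidableEq V]
    (G : SimpleGraph V) [DecidableRel G.Adj] (hm : Fintype.card V < G.edgeFinset.card) :
    ∃ f ≠ 0, groverMatrix G *ᵥ f = (-1 : ℂ) • f :=
  exists_groverMatrix_eigenvector_of_weight G hm (-1) (fun _ => 1) (by simp) (by simp)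

lemma exists_probTransMatrix_eigenvector {V : Type*} [Fintype V] [DecidableEq V]
    (G : SimpleGraph V) [DecidableRel G.Adj] (hdeg : ∀ v, G.degree v ≠ 0) {c : ℂ}
    (hc : c ^ 2 - 1 ≠ 0) {f : G.Dart → ℂ} (hf : f ≠ 0) (hfc : groverMatrix G *ᵥ f = c • f) :
    ∃ μ : ℂ, (∃ φ ≠ 0, probTransMatrix G *ᵥ φ = μ • φ) ∧ c ^ 2 - 2 * μ * c + 1 = 0 := by
  have hdeg' (v : V) : (G.degree v : ℂ) ≠ 0 := Nat.cast_ne_zero.2 (hdeg v)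
  set F : V → ℂ := fun v => ∑ b : G.Dart, if b.snd = v then f b else 0 with hF
  set φ : V → ℂ := fun v => F v / G.degree v with hφ
  have hU (a : G.Dart) : 2 * φ a.fst - f a.symm = c * f a := by
    have := congrFun hfc a
    rw [groverMatrix_mulVec] at this
    rw [← smul_eq_mul c, ← Pi.smul_apply, ← this]
    simp only [hφ, hF]
    ring
  have hfφ (a : G.Dart) : (c ^ 2 - 1) * f a = 2 * c * φ a.fst - 2 * φ a.snd := by
    have h₁ := hU a
    have h₂ : 2 * φ a.snd - f a = c * f a.symm := by simpa using hU a.symm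
    linear_combination (-c) * h₁ + h₂
  have hφ0 : φ ≠ 0 := by
    contrapose! hf
    ext a
    simpa [hf, hc] using hfφ a
  have hsum (v : V) : (c ^ 2 + 1) * φ v = 2 * c * (probTransMatrix G *ᵥ φ) v := by
    have h : (c ^ 2 - 1) * F v =
        ∑ u ∈ G.neighborFinset v, (2 * c * φ u - 2 * φ v) := by
      rw [← sum_dart_snd_eq G v fun u => 2 * c * φ u - 2 * φ v, hF, Finset.mul_sum]
      refine Finset.sum_congr rfl fun b _ => ?_
      split_ifs with hb
      · rw [hfφ b, hb]
      · simp
    rw [Finset.sum_sub_distrib, ← Finset.mul_sum, Finset.sum_const, nsmul_eq_mul,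
      SimpleGraph.card_neighborFinset_eq_degree] at h
    have hFφ : F v = G.degree v * φ v := (mul_div_cancel₀ _ (hdeg' v)).symm
    rw [probTransMatrix_mulVec, ← mul_div_assoc (2 * c), eq_div_iff (hdeg' v)]
    rw [hFφ] at h
    linear_combination h
  have hc0 : c ≠ 0 := by
    rintro rfl
    exact hφ0 (funext fun v => by simpa using hsum v)
  refine ⟨(c ^ 2 + 1) / (2 * c), ⟨φ, hφ0, ?_⟩, by field_simp; ring⟩
  ext v
  rw [Pi.smul_apply, smul_eq_mul, div_mul_eq_mul_div, hsum v]
  field_simp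

lemma exists_groverMatrix_eigenvector {V : Type*} [Fintype V] [DecidableEq V]
    (G : SimpleGraph V) [DecidableRel G.Adj] (hdeg : ∀ v, G.degree v ≠ 0) {c μ : ℂ}
    (hc : c ^ 2 - 1 ≠ 0) (hμ : c ^ 2 - 2 * μ * c + 1 = 0) {φ : V → ℂ} (hφ : φ ≠ 0)
    (hφμ : probTransMatrix G *ᵥ φ = μ • φ) :
    ∃ f ≠ 0, groverMatrix G *ᵥ f = c • f := by
  have hdeg' (v : V) : (G.degree v : ℂ) ≠ 0 := Nat.cast_ne_zero.2 (hdeg v)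
  refine ⟨fun a => c * φ a.fst - φ a.snd, ?_, ?_⟩
  · contrapose! hφ
    ext u
    obtain ⟨v, huv⟩ := (G.degree_pos_iff_exists_adj u).1 (Nat.pos_of_ne_zero (hdeg u))
    have h₁ : c * φ u - φ v = 0 := congrFun hφ ⟨(u, v), huv⟩
    have h₂ : c * φ v - φ u = 0 := congrFun hφ ⟨(v, u), huv.symm⟩
    have : (c ^ 2 - 1) * φ u = 0 := by linear_combination c * h₁ + h₂
    exact (mul_eq_zero.1 this).resolve_left hc
  · ext a
    have hT := congrFun hφμ a.fst
    rw [probTransMatrix_mulVec, div_eq_iff (hdeg' _), Pi.smul_apply, smul_eq_mul] at hT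
    have hsum : (∑ b : G.Dart, if b.snd = a.fst then c * φ b.fst - φ b.snd else 0) =
        G.degree a.fst * ((c * μ - 1) * φ a.fst) := by
      calc _ = ∑ b : G.Dart, (if b.snd = a.fst then c * φ b.fst - φ a.fst else 0) := by
            refine Finset.sum_congr rfl fun b _ => ?_
            split_ifs with hb
            · rw [hb]
            · rfl
        _ = _ := by
            rw [sum_dart_snd_eq G a.fst fun u => c * φ u - φ a.fst, Finset.sum_sub_distrib,
              ← Finset.mul_sum, hT, Finset.sum_const, nsmul_eq_mul,
              SimpleGraph.card_neighborFinset_eq_degree]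
            ring
    rw [groverMatrix_mulVec, hsum, ← mul_assoc, div_mul_cancel₀ _ (hdeg' _)]
    simp only [SimpleGraph.Dart.symm_toProd, Prod.fst_swap, Prod.snd_swap, Pi.smul_apply,
      smul_eq_mul]
    linear_combination (-φ a.fst) * hμ

theorem grover_spectrum {V : Type*} [Fintype V] [DecidableEq V] (G : SimpleGraph V)
    [DecidableRel G.Adj] (hconn : G.Connected)
    (hm : Fintype.card V < G.edgeFinset.card) (lam : ℂ) :
    Matrix.det (lam • (1 : Matrix G.Dart G.Dart ℂ) - groverMatrix G) = 0 ↔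
      (lam = 1 ∨ lam = -1) ∨
        ∃ μ : ℂ, Matrix.det (μ • (1 : Matrix V V ℂ) - probTransMatrix G) = 0 ∧
          lam ^ 2 - 2 * μ * lam + 1 = 0 := by
  have hdeg (v : V) : G.degree v ≠ 0 := by
    obtain ⟨e, he⟩ := Finset.card_pos.1 (Nat.zero_lt_of_lt hm)
    have : Nontrivial V := by
      induction e with
      | _ x y => exact ⟨x, y, (SimpleGraph.mem_edgeFinset.1 he : G.Adj x y).ne⟩
    exact (hconn.preconnected.degree_pos_of_nontrivial v).ne'
  simp only [det_smul_one_sub_eq_zero_iff]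
  by_cases h : lam ^ 2 - 1 = 0
  · have h' : lam = 1 ∨ lam = -1 := sq_eq_one_iff.1 (sub_eq_zero.1 h)
    refine iff_of_true ?_ (Or.inl h')
    rcases h' with rfl | rfl
    · exact exists_groverMatrix_eigenvector_one G hm
    · exact exists_groverMatrix_eigenvector_neg_one G hm
  · have h' : ¬(lam = 1 ∨ lam = -1) := by
      rintro (rfl | rfl) <;> norm_num at h
    rw [or_iff_right h']
    constructor
    · rintro ⟨f, hf, hfc⟩
      exact exists_probTransMatrix_eigenvector G hdeg h hf hfc
    · rintro ⟨μ, ⟨φ, hφ, hφμ⟩, hμ⟩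
      exact exists_groverMatrix_eigenvector G hdeg h hμ hφ hφμ
end

section
/- Let G be a finite simple graph, τ, υ : darts → ℂ, and M the edge matrix of the generalized weighted zeta function. Let t ∈ ℂ be such that 1 − t²·υ(a)·υ(ā) ≠ 0 for every dart a. Define the weighted adjacency matrix A_θ, indexed by vertices, by A_θ(u,v) = Σ_{a : tail(a)=u, head(a)=v} τ(a)/(1 − t²·υ(a)·υ(ā)), and the weighted degree matrix D_θ, a diagonal matrix indexed by vertices, by D_θ(u,u) = Σ_{a : tail(a)=u} τ(a)·υ(ā)/(1 − t²·υ(a)·υ(ā)). Then det(I − t·M) = (∏_{e ∈ E(G)} (1 − t²·υ(a_e)·υ(ā_e))) · det(I − t·A_θ + t²·D_θ), where for each edge e, a_e and ā_e are the two darts of e. -/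
open Matrix

/-- The edge matrix of the generalized weighted zeta function:
`M(a,a') = τ(a')·[head a = tail a'] − υ(a')·[a' = ā]`. -/
noncomputable def edgeMatrix {V : Type*} [Fintype V] [DecidableEq V] (G : SimpleGraph V)
    [DecidableRel G.Adj] (τ υ : G.Dart → ℂ) : Matrix G.Dart G.Dart ℂ := fun a a' =>
  τ a' * (if a.snd = a'.fst then 1 else 0) - υ a' * (if a' = a.symm then 1 else 0)

/-- The weighted reversal of darts, with entries `υ(a')·[a' = ā]`. -/
def weightedReversal {V R : Type*} [DecidableEq V] [CommRing R] (G : SimpleGraph V)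
    (υ : G.Dart → R) : Matrix G.Dart G.Dart R :=
  Matrix.of fun a a' => if a' = a.symm then υ a' else 0

theorem weightedReversal_mul_apply {V R n : Type*} [Fintype V] [DecidableEq V] [CommRing R]
    (G : SimpleGraph V) [DecidableRel G.Adj] (υ : G.Dart → R) (A : Matrix G.Dart n R)
    (a : G.Dart) (j : n) : (weightedReversal G υ * A) a j = υ a.symm * A a.symm j := by
  simp [weightedReversal, mul_apply]

/-- An orientation of the edges splits the darts into the chosen ones and their reversals. -/
noncomputable def dartEquivOfOrientation {V : Type*} [Fintype V] [DecidableEq V]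
    (G : SimpleGraph V) [DecidableRel G.Adj] (orient : Sym2 V → G.Dart)
    (horient : ∀ e ∈ G.edgeFinset, (orient e).edge = e) :
    {e // e ∈ G.edgeFinset} ⊕ {e // e ∈ G.edgeFinset} ≃ G.Dart :=
  Equiv.ofBijective (Sum.elim (fun e => orient e) (fun e => (orient e).symm)) <| by
    have key : ∀ e f : {e // e ∈ G.edgeFinset},
        (orient e).edge = (orient f).edge → e = f := fun e f h =>
      Subtype.ext (by rw [← horient e e.2, h, horient f f.2])
    refine ⟨?_, fun a => ?_⟩
    · rintro (e | e) (f | f) h <;> simp only [Sum.elim_inl, Sum.elim_inr] at h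
      · rw [key e f (by rw [h])]
      · obtain rfl := key e f (by rw [h, SimpleGraph.Dart.edge_symm])
        exact absurd h.symm (SimpleGraph.Dart.symm_ne _)
      · obtain rfl := key e f (by rw [← h, SimpleGraph.Dart.edge_symm])
        exact absurd h (SimpleGraph.Dart.symm_ne _)
      · rw [key e f (by rw [← SimpleGraph.Dart.edge_symm, h, SimpleGraph.Dart.edge_symm])]
    · have ha : a.edge ∈ G.edgeFinset := by simp
      rcases (SimpleGraph.dart_edge_eq_iff _ _).1 (horient _ ha) with h | h
      · exact ⟨Sum.inl ⟨_, ha⟩, h⟩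
      · exact ⟨Sum.inr ⟨_, ha⟩, by simp [h]⟩

theorem det_one_add_smul_weightedReversal {V R : Type*} [Fintype V] [DecidableEq V] [CommRing R]
    (G : SimpleGraph V) [DecidableRel G.Adj] (υ : G.Dart → R) (t : R)
    (orient : Sym2 V → G.Dart) (horient : ∀ e ∈ G.edgeFinset, (orient e).edge = e) :
    Matrix.det (1 + t • weightedReversal G υ) =
      ∏ e ∈ G.edgeFinset, (1 - t ^ 2 * υ (orient e) * υ (orient e).symm) := by
  let f := dartEquivOfOrientation G orient horient
  have hl (e) : f (Sum.inl e) = orient e := rfl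
  have hr (e) : f (Sum.inr e) = (orient e).symm := rfl
  have hsymm (x) : (f x).symm = f x.swap := by
    cases x <;> simp [hl, hr]
  have hblock : (1 + t • weightedReversal G υ).submatrix f f =
      fromBlocks 1 (diagonal fun e : {e // e ∈ G.edgeFinset} => t * υ (orient e).symm)
        (diagonal fun e : {e // e ∈ G.edgeFinset} => t * υ (orient e)) 1 := by
    ext x y
    simp only [submatrix_apply, Matrix.add_apply, Matrix.smul_apply, weightedReversal, of_apply, hsymm,
      one_apply, f.injective.eq_iff]
    rcases x with x | x <;> rcases y with y | y <;>
      simp [hl, hr, one_apply, diagonal_apply, eq_comm] <;> grind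
  rw [← det_submatrix_equiv_self f, hblock, det_fromBlocks_one₁₁, diagonal_mul_diagonal,
    ← diagonal_one, diagonal_sub, det_diagonal, ← Finset.prod_coe_sort G.edgeFinset]
  exact Finset.prod_congr rfl fun e _ => by ring

theorem one_add_smul_weightedReversal_mul {V K : Type*} [Fintype V] [DecidableEq V] [Field K]
    (G : SimpleGraph V) [DecidableRel G.Adj] (υ : G.Dart → K) (t : K)
    (ht : ∀ a : G.Dart, 1 - t ^ 2 * υ a * υ a.symm ≠ 0) :
    (1 + t • weightedReversal G υ) * ((1 - t • weightedReversal G υ) *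
      diagonal fun a => (1 - t ^ 2 * υ a * υ a.symm)⁻¹) = 1 := by
  have hsq : weightedReversal G υ * weightedReversal G υ =
      diagonal fun a => υ a * υ a.symm := by
    ext a b
    rw [weightedReversal_mul_apply, diagonal_apply]
    by_cases h : a = b
    · subst h
      simp [weightedReversal, mul_comm]
    · simp [weightedReversal, h, Ne.symm h]
  have hprod : (1 + t • weightedReversal G υ) * (1 - t • weightedReversal G υ) =
      diagonal fun a => 1 - t ^ 2 * υ a * υ a.symm := by
    have : (1 + t • weightedReversal G υ) * (1 - t • weightedReversal G υ) =
        1 - (t * t) • (weightedReversal G υ * weightedReversal G υ) := by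
      simp only [add_mul, mul_sub, one_mul, mul_one, smul_mul_smul_comm]
      abel
    rw [this, hsq, ← diagonal_one, ← diagonal_smul, diagonal_sub]
    congr 1
    ext a
    simp only [Pi.smul_apply, smul_eq_mul]
    ring
  rw [← Matrix.mul_assoc, hprod, diagonal_mul_diagonal, ← diagonal_one]
  congr 1
  ext a
  exact mul_inv_cancel₀ (ht a)

theorem ihara_expression {V : Type*} [Fintype V] [DecidableEq V] (G : SimpleGraph V)
    [DecidableRel G.Adj] (τ υ : G.Dart → ℂ) (t : ℂ)
    (ht : ∀ a : G.Dart, 1 - t ^ 2 * υ a * υ a.symm ≠ 0)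
    (orient : Sym2 V → G.Dart) (horient : ∀ e ∈ G.edgeFinset, (orient e).edge = e) :
    Matrix.det ((1 : Matrix G.Dart G.Dart ℂ) - t • edgeMatrix G τ υ) =
      (∏ e ∈ G.edgeFinset, (1 - t ^ 2 * υ (orient e) * υ (orient e).symm)) *
        Matrix.det ((1 : Matrix V V ℂ) -
          t • (Matrix.of fun u v : V =>
            ∑ a ∈ Finset.univ.filter (fun a : G.Dart => a.fst = u ∧ a.snd = v),
              τ a / (1 - t ^ 2 * υ a * υ a.symm)) +
          t ^ 2 • (Matrix.of fun u v : V =>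
            if u = v then
              ∑ a ∈ Finset.univ.filter (fun a : G.Dart => a.fst = u),
                τ a * υ a.symm / (1 - t ^ 2 * υ a * υ a.symm)
            else 0)) := by
  set J := weightedReversal G υ
  set D : Matrix G.Dart G.Dart ℂ := diagonal fun a => (1 - t ^ 2 * υ a * υ a.symm)⁻¹ with hD
  let H : Matrix G.Dart V ℂ := Matrix.of fun a v => if a.snd = v then 1 else 0
  let T : Matrix V G.Dart ℂ := Matrix.of fun v a => if a.fst = v then τ a else 0
  have hM : edgeMatrix G τ υ = H * T - J := by
    ext a b
    simp [edgeMatrix, H, T, J, weightedReversal, mul_apply, eq_comm]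
  have hinv : (1 + t • J) * ((1 - t • J) * D) = 1 := one_add_smul_weightedReversal_mul G υ t ht
  have hfactor : 1 - t • edgeMatrix G τ υ =
      (1 + t • J) * (1 - (t • ((1 - t • J) * D * H)) * T) := by
    rw [Matrix.mul_sub, Matrix.mul_one, Matrix.smul_mul, Matrix.mul_smul, Matrix.mul_assoc _ H T,
      ← Matrix.mul_assoc (1 + t • J), hinv, Matrix.one_mul, hM, smul_sub]
    abel
  rw [hfactor, det_mul, det_one_add_smul_weightedReversal G υ t orient horient,
    det_one_sub_mul_comm]
  have hsplit : T * (t • ((1 - t • J) * D * H)) = t • (T * (D * H)) - t ^ 2 • (T * (J * D * H)) := by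
    simp only [Matrix.sub_mul, Matrix.one_mul, Matrix.smul_mul, Matrix.mul_smul, Matrix.mul_sub,
      smul_sub, smul_smul, pow_two]
  rw [hsplit, ← sub_add]
  have hDH (a : G.Dart) (v : V) : (D * H) a v =
      (1 - t ^ 2 * υ a * υ a.symm)⁻¹ * if a.snd = v then 1 else 0 := by
    simp only [hD, diagonal_mul, H, of_apply]
  congr 4
  · congr 1
    ext u v
    simp only [mul_apply (M := T), hDH, T, of_apply, Finset.sum_filter]
    refine Finset.sum_congr rfl fun a _ => ?_
    split_ifs <;> simp_all [div_eq_mul_inv]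
  · ext u v
    have hJDH (a : G.Dart) : (J * D * H) a v =
        if a.fst = v then υ a.symm / (1 - t ^ 2 * υ a * υ a.symm) else 0 := by
      rw [Matrix.mul_assoc, weightedReversal_mul_apply, hDH]
      simp [div_eq_mul_inv, mul_right_comm _ (υ a)]
    simp only [mul_apply (M := T), hJDH, T, of_apply]
    split_ifs with huv
    · subst huv
      rw [Finset.sum_filter]
      refine Finset.sum_congr rfl fun a _ => ?_
      split_ifs <;> simp [mul_div_assoc]
    · refine Finset.sum_eq_zero fun a _ => ?_
      split_ifs <;> simp_all
end

section
/- Let G be a finite simple graph, τ : darts → ℂ, and M_S the Sato edge matrix. If M_S is unitary, then τ(a) = τ(a') for all darts a, a' with tail(a) = tail(a'); that is, τ is constant on the set of darts emanating from each fixed vertex. -/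
open Matrix

/-- The Sato edge matrix for a weight `τ` on the darts of a finite simple graph:
`M_S(a,a') = τ(a')·[head a = tail a'] − [a' = ā]`. -/
noncomputable def satoMatrix {V : Type*} [Fintype V] [DecidableEq V] (G : SimpleGraph V)
    [DecidableRel G.Adj] (τ : G.Dart → ℂ) : Matrix G.Dart G.Dart ℂ := fun a a' =>
  τ a' * (if a.snd = a'.fst then 1 else 0) - (if a' = a.symm then 1 else 0)

/-- The Gram matrix of the Sato edge matrix at two darts with a common tail; the coefficient
`∑ c, [c.fst = a.fst]` is the degree of that tail. -/
lemma conjTranspose_mul_satoMatrix_apply {V : Type*} [Fintype V] [DecidableEq V]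
    (G : SimpleGraph V) [DecidableRel G.Adj] (τ : G.Dart → ℂ) {a a' : G.Dart}
    (h : a.fst = a'.fst) :
    ((satoMatrix G τ)ᴴ * satoMatrix G τ) a a' =
      (∑ c : G.Dart, if c.fst = a.fst then 1 else 0) * (star (τ a) * τ a') - star (τ a) - τ a'
        + (1 : Matrix G.Dart G.Dart ℂ) a a' := by
  have key : ∀ c : G.Dart, star (satoMatrix G τ c.symm a) * satoMatrix G τ c.symm a' =
      (if c.fst = a.fst then 1 else 0) * (star (τ a) * τ a')
        - (if a' = c then star (τ a) else 0) - (if a = c then τ a' else 0)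
        + (if a = c then (if a = a' then 1 else 0) else 0) := by
    intro c
    simp only [satoMatrix, SimpleGraph.Dart.symm_symm]
    have hs : c.symm.snd = c.fst := rfl
    rw [hs]
    by_cases h1 : a = c <;> by_cases h2 : a' = c
    · subst h1; subst h2; simp; ring
    · subst h1
      simp [h, h2, Ne.symm h2]
      ring
    · subst h2
      simp [h, h1]
      ring
    · by_cases h3 : c.fst = a.fst <;> simp [h1, h2, h3, ← h]
  rw [mul_apply, ← Equiv.sum_comp (SimpleGraph.Dart.symm_involutive (G := G)).toPerm]
  simp only [conjTranspose_apply, Function.Involutive.coe_toPerm, key]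
  simp only [Finset.sum_add_distrib, Finset.sum_sub_distrib, ← Finset.sum_mul]
  simp [one_apply]

theorem sato_unitary_tau_locally_constant {V : Type*} [Fintype V] [DecidableEq V]
    (G : SimpleGraph V) [DecidableRel G.Adj] (τ : G.Dart → ℂ)
    (hU : (satoMatrix G τ)ᴴ * satoMatrix G τ = 1) :
    ∀ a a' : G.Dart, a.fst = a'.fst → τ a = τ a' := by
  intro a a' h
  have diag := conjTranspose_mul_satoMatrix_apply G τ (rfl : a.fst = a.fst)
  have offDiag := conjTranspose_mul_satoMatrix_apply G τ h
  rw [hU] at diag offDiag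
  generalize (∑ c : G.Dart, if c.fst = a.fst then (1 : ℂ) else 0) = d at diag offDiag
  have hprod : (d * star (τ a) - 1) * (τ a - τ a') = 0 := by
    linear_combination offDiag - diag
  rcases mul_eq_zero.mp hprod with hd | hτ
  · have hz : star (τ a) = 0 := by linear_combination diag + τ a * hd
    simp [hz] at hd
  · exact sub_eq_zero.mp hτ
end
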